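/- arXiv:2006.03691 — 6 statements merged into one kernel-verified Lean document; each statement's English description precedes it below -/
import Mathlib

section
/- Let H be a finite digraph and D a finite H-colored digraph with a partition {ξ_1, ξ_2} of ξ. Suppose that (1) for each i ∈ {1, 2} and each H-walk P contained in D_i there exists m' ∈ {1, …, k} such that P is contained in G_{m'}, and (2) if (a, b) is a ξ_1ξ_2-arc or a ξ_2ξ_1-arc of 𝒞_C(D), then (a, b) ∉ A(H). Then every H-walk of D is contained in either D_1 or D_2; moreover, for each H-walk T of D there exists l ∈ {1, …, k} such that T is contained in G_l. -/
/- Digraphs are modeled as binary relations on a vertex type.  An `H`-colored digraph `D`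
is a relation `D : V → V → Prop` together with a coloring `c : V → V → β` of its arcs by
vertices of a digraph `H : β → β → Prop` (possibly with loops). -/

variable {V β : Type*}

/-- The list of colors of the consecutive arcs along a list of vertices. -/
def arcColors (c : V → V → β) (l : List V) : List β :=
  (l.zip l.tail).map fun p => c p.1 p.2

/-- `l` is an `H`-walk in the digraph with arc relation `A`: it has at least two vertices
(i.e. at least one arc), its consecutive pairs are arcs of `A`, and the sequence of colors
of its consecutive arcs is a walk in `H`. -/
def IsHWalk (A : V → V → Prop) (c : V → V → β) (H : β → β → Prop) (l : List V) : Prop :=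
  2 ≤ l.length ∧ l.Chain' A ∧ (arcColors c l).Chain' H

/-- An `H`-path: an `H`-walk with pairwise distinct vertices. -/
def IsHPath (A : V → V → Prop) (c : V → V → β) (H : β → β → Prop) (l : List V) : Prop :=
  IsHWalk A c H l ∧ l.Nodup

/-- An `H`-path from `u` to `v`. -/
def IsHPathFrom (A : V → V → Prop) (c : V → V → β) (H : β → β → Prop) (u v : V)
    (l : List V) : Prop :=
  IsHPath A c H l ∧ l.head? = some u ∧ l.getLast? = some v

/-- There exists a `uv`-`H`-path in the digraph with arc relation `A`. -/
def HPathExists (A : V → V → Prop) (c : V → V → β) (H : β → β → Prop) (u v : V) : Prop :=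
  ∃ l, IsHPathFrom A c H u v l

/-- The digraph with arc relation `A` is transitive by `H`-paths. -/
def TransByHPaths (A : V → V → Prop) (c : V → V → β) (H : β → β → Prop) : Prop :=
  ∀ x y z, HPathExists A c H x y → HPathExists A c H y z → HPathExists A c H x z

/-- Arc relation of the subdigraph of `D` induced by the arcs whose color lies in `Cl`. -/
def Garc (D : V → V → Prop) (c : V → V → β) (Cl : Set β) : V → V → Prop :=
  fun u v => D u v ∧ c u v ∈ Cl

/-- Given a partition `C : Fin k → Set β` of the colors and an assignment `σ` of the classes
to two parts, `DarcPart D c C σ j` is the arc relation of the spanning subdigraph `D_j`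
whose arcs are those of `D` colored in some class of part `j`. -/
def DarcPart (D : V → V → Prop) (c : V → V → β) {k : ℕ} (C : Fin k → Set β)
    (σ : Fin k → Fin 2) (j : Fin 2) : V → V → Prop :=
  Garc D c {b | ∃ m, σ m = j ∧ b ∈ C m}

/-- `l` (a list of pairwise distinct vertices, of length at least two) is a directed cycle
of the digraph with arc relation `A`, the closing arc going from the last vertex back to
the first one. -/
def IsCycle (A : V → V → Prop) (l : List V) : Prop :=
  2 ≤ l.length ∧ l.Nodup ∧ l.Chain' A ∧
    ∀ x ∈ l.getLast?, ∀ y ∈ l.head?, A x y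

/-- Arc relation of the color-class digraph `𝒞_C(D)`: `(a, b)` is an arc iff there are arcs
`(u,v)` and `(v,w)` of `D` with colors `a` and `b` respectively. -/
def CCArc (D : V → V → Prop) (c : V → V → β) (a b : β) : Prop :=
  ∃ u v w, D u v ∧ D v w ∧ c u v = a ∧ c v w = b

/-- `S` is `H`-independent: no `H`-path between two distinct vertices of `S`. -/
def HIndep (A : V → V → Prop) (c : V → V → β) (H : β → β → Prop) (S : Set V) : Prop :=
  ∀ u ∈ S, ∀ v ∈ S, u ≠ v → ¬ HPathExists A c H u v

/-- `S` is `H`-absorbent: from every vertex outside `S` there is an `H`-path to `S`. -/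
def HAbsorbent (A : V → V → Prop) (c : V → V → β) (H : β → β → Prop) (S : Set V) : Prop :=
  ∀ u, u ∉ S → ∃ v ∈ S, HPathExists A c H u v

/-- An `H`-kernel: an `H`-independent and `H`-absorbent set. -/
def IsHKernel (A : V → V → Prop) (c : V → V → β) (H : β → β → Prop) (S : Set V) : Prop :=
  HIndep A c H S ∧ HAbsorbent A c H S

/-- `S` is an `H`-semikernel of the digraph with arc relation `A`. -/
def IsHSemikernel (A : V → V → Prop) (c : V → V → β) (H : β → β → Prop) (S : Set V) : Prop :=
  HIndep A c H S ∧
    ∀ z, z ∉ S → (∃ s ∈ S, HPathExists A c H s z) → ∃ s ∈ S, HPathExists A c H z s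

/-- `S` is an `H`-semikernel modulo `D₂` of `D` (here `A` is the arc relation of `D` and
`A1` that of `D₁`): `S` is `H`-independent in `D` and whenever there is an `H`-path
contained in `D₁` from `S` to a vertex `z ∉ S`, there is an `H`-path in `D` from `z` to `S`. -/
def IsHSemikernelMod (A A1 : V → V → Prop) (c : V → V → β) (H : β → β → Prop)
    (S : Set V) : Prop :=
  HIndep A c H S ∧
    ∀ z, z ∉ S → (∃ s ∈ S, HPathExists A1 c H s z) → ∃ s ∈ S, HPathExists A c H z s

/-- There is an `H`-obstruction at the common vertex of the concatenation of `P` and `Q`: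
the pair (color of last arc of `P`, color of first arc of `Q`) is not an arc of `H`. -/
def Obstruct (c : V → V → β) (H : β → β → Prop) (P Q : List V) : Prop :=
  ∀ a ∈ (arcColors c P).getLast?, ∀ b ∈ (arcColors c Q).head?, ¬ H a b

/-- A `ux`-path which is a `(ξ₁, ξ, ξ₂)`-`H`-subdivision of `P⃗₃`: a path of `D` (arc
relation `A`) from `u` to `x` consisting of an `H`-path contained in `D₁` (arc relation
`A1`), followed by an `H`-path contained in `D`, followed by an `H`-path contained in `D₂`
(arc relation `A2`), with `H`-obstructions at the two junction vertices. -/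
def SubdivP3 (A1 A A2 : V → V → Prop) (c : V → V → β) (H : β → β → Prop) (u x : V) : Prop :=
  ∃ P1 P2 P3 : List V,
    IsHPath A1 c H P1 ∧ IsHPath A c H P2 ∧ IsHPath A2 c H P3 ∧
    P1.head? = some u ∧ P3.getLast? = some x ∧
    P1.getLast? = P2.head? ∧ P2.getLast? = P3.head? ∧
    (P1 ++ P2.tail ++ P3.tail).Nodup ∧
    Obstruct c H P1 P2 ∧ Obstruct c H P2 P3

/-- A `(ξ₁, ξ, ξ₂)`-`H`-subdivision of `C⃗₃`: a cycle of `D` consisting of an `H`-path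
contained in `D₁`, followed by an `H`-path contained in `D`, followed by an `H`-path
contained in `D₂` closing the cycle, with `H`-obstructions at the three junction vertices. -/
def SubdivC3 (A1 A A2 : V → V → Prop) (c : V → V → β) (H : β → β → Prop) : Prop :=
  ∃ P1 P2 P3 : List V,
    IsHPath A1 c H P1 ∧ IsHPath A c H P2 ∧ IsHPath A2 c H P3 ∧
    P1.getLast? = P2.head? ∧ P2.getLast? = P3.head? ∧ P3.getLast? = P1.head? ∧
    (P1 ++ P2.tail ++ P3.tail.dropLast).Nodup ∧
    Obstruct c H P3 P1 ∧ Obstruct c H P1 P2 ∧ Obstruct c H P2 P3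

/-- There is a rainbow path (a path all of whose arc colors are pairwise distinct) from
`u` to `v` in the digraph with arc relation `A`. -/
def RainbowPathExists (A : V → V → Prop) (c : V → V → β) (u v : V) : Prop :=
  ∃ l, IsHPathFrom A c (fun _ _ => True) u v l ∧ (arcColors c l).Nodup

/-- If no consecutive arcs `(u, v)`, `(v, w)` of `D` with `H`-adjacent colors leave the color
set `S`, then an `H`-walk whose first arc is colored in `S` has all its arcs colored in `S`. -/
theorem IsHWalk.garc_of_closed {D : V → V → Prop} {c : V → V → β} {H : β → β → Prop}
    {S : Set β}
    (hS : ∀ u v w, D u v → D v w → H (c u v) (c v w) → c u v ∈ S → c v w ∈ S)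
    {t : List V} {u v : V} (hT : IsHWalk D c H (u :: v :: t)) (huv : c u v ∈ S) :
    IsHWalk (Garc D c S) c H (u :: v :: t) := by
  obtain ⟨hlen, hD, hH⟩ := hT
  refine ⟨hlen, ?_, hH⟩
  clear hlen
  induction t generalizing u v with
  | nil =>
    simp only [List.Chain', List.isChain_cons_cons] at hD ⊢
    exact ⟨⟨hD.1, huv⟩, List.isChain_singleton v⟩
  | cons w t ih =>
    simp only [List.Chain', arcColors, List.tail_cons, List.zip_cons_cons, List.map_cons,
      List.isChain_cons_cons] at hD hH ih ⊢
    have hvw := hS u v w hD.1 hD.2.1 hH.1 huv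
    exact ⟨⟨hD.1, huv⟩, ih hvw hD.2 hH.2⟩

theorem statement_9
    {V β : Type*} [Fintype V] [Fintype β]
    (H : β → β → Prop) (D : V → V → Prop) (c : V → V → β)
    (hloop : ∀ v : V, ¬ D v v)
    (k : ℕ) (hk : 2 ≤ k) (C : Fin k → Set β)
    (hdisj : ∀ i j : Fin k, i ≠ j → Disjoint (C i) (C j))
    (hcover : ∀ b : β, ∃ i : Fin k, b ∈ C i)
    (harc : ∀ i : Fin k, ∃ u v : V, D u v ∧ c u v ∈ C i)
    (htrans : ∀ i : Fin k, TransByHPaths (Garc D c (C i)) c H)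
    (σ : Fin k → Fin 2) (hσ : ∀ j : Fin 2, ∃ i : Fin k, σ i = j)
    (h1 : ∀ j : Fin 2, ∀ P : List V, IsHWalk (DarcPart D c C σ j) c H P →
        ∃ m : Fin k, σ m = j ∧ IsHWalk (Garc D c (C m)) c H P)
    (h2 : ∀ a b : β, CCArc D c a b →
        (((∃ m, σ m = 0 ∧ a ∈ C m) ∧ (∃ m, σ m = 1 ∧ b ∈ C m)) ∨
         ((∃ m, σ m = 1 ∧ a ∈ C m) ∧ (∃ m, σ m = 0 ∧ b ∈ C m))) → ¬ H a b) :
    ∀ T : List V, IsHWalk D c H T →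
      (IsHWalk (DarcPart D c C σ 0) c H T ∨ IsHWalk (DarcPart D c C σ 1) c H T) ∧
      ∃ l : Fin k, IsHWalk (Garc D c (C l)) c H T := by
  intro T hT
  have closed (j : Fin 2) (u v w : V) (huv : D u v) (hvw : D v w)
      (hH : H (c u v) (c v w)) (hj : c u v ∈ {b | ∃ m, σ m = j ∧ b ∈ C m}) :
      c v w ∈ {b | ∃ m, σ m = j ∧ b ∈ C m} := by
    obtain ⟨n, hn⟩ := hcover (c v w)
    by_cases hnj : σ n = j
    · exact ⟨n, hnj, hn⟩
    · refine absurd hH (h2 _ _ ⟨u, v, w, huv, hvw, rfl, rfl⟩ ?_)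
      obtain rfl | rfl : j = 0 ∨ j = 1 := by omega
      · exact Or.inl ⟨hj, n, by omega, hn⟩
      · exact Or.inr ⟨hj, n, by omega, hn⟩
  have part : ∃ j, IsHWalk (DarcPart D c C σ j) c H T := by
    match T, hT with
    | [], hT => exact absurd hT.1 (by simp)
    | [_], hT => exact absurd hT.1 (by simp)
    | u :: v :: _, hT =>
      obtain ⟨m, hm⟩ := hcover (c u v)
      exact ⟨σ m, hT.garc_of_closed (closed (σ m)) ⟨m, rfl, hm⟩⟩
  obtain ⟨j, hj⟩ := part
  obtain ⟨l, -, hl⟩ := h1 j T hj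
  refine ⟨?_, l, hl⟩
  obtain rfl | rfl : j = 0 ∨ j = 1 := by omega
  · exact Or.inl hj
  · exact Or.inr hj
end

section
/- Let D be a finite 3-transitive digraph and let H_1 and H_2 be two spanning subdigraphs of D such that A(H_1) ∩ A(H_2) = ∅ and A(H_1) ∪ A(H_2) = A(D). If D contains no directed cycle of length 3 and, for every i ∈ {1, 2}, H_i is an acyclic digraph, then D has a kernel. -/
/- Digraphs are modeled as binary relations on a vertex type.  An `H`-colored digraph `D`
is a relation `D : V → V → Prop` together with a coloring `c : V → V → β` of its arcs by
vertices of a digraph `H : β → β → Prop` (possibly with loops). -/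

variable {V β : Type*}

/-- In a 3-transitive digraph, reachability is realized by a walk of length at most two. -/
theorem reflTransGen_cases_of_three_transitive {V : Type*} {D : V → V → Prop}
    (h3 : ∀ u v w x : V, D u v → D v w → D w x → D u x) {u v : V}
    (h : Relation.ReflTransGen D u v) : v = u ∨ D u v ∨ ∃ w, D u w ∧ D w v := by
  induction h with
  | refl => exact Or.inl rfl
  | tail _ hab ih =>
    rcases ih with rfl | h | ⟨w, h, h'⟩
    · exact Or.inr (Or.inl hab)
    · exact Or.inr (Or.inr ⟨_, h, hab⟩)
    · exact Or.inr (Or.inl (h3 _ _ _ _ h h' hab))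

/-- A finite digraph has a vertex in a terminal strong component. -/
theorem exists_forall_reflTransGen_symm {V : Type*} [Finite V] [Nonempty V]
    (D : V → V → Prop) :
    ∃ u, ∀ v, Relation.ReflTransGen D u v → Relation.ReflTransGen D v u := by
  let _ : Preorder V :=
    { le := Relation.ReflTransGen D
      le_refl := fun _ => Relation.ReflTransGen.refl
      le_trans := fun _ _ _ => Relation.ReflTransGen.trans }
  obtain ⟨u, hu⟩ := (Set.finite_univ (α := V)).exists_maximal Set.univ_nonempty
  exact ⟨u, fun v hv => hu.2 (Set.mem_univ v) hv⟩

/-- A finite loopless digraph in which every walk of length three is short-cut by an arc has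
a kernel. The vertices reachable by even walks from a vertex of a terminal strong component
form an independent set; the vertices it does not absorb are handled by induction. -/
theorem exists_kernel_of_three_transitive {V : Type*} [Finite V] (D : V → V → Prop)
    (hloop : ∀ v : V, ¬ D v v)
    (h3 : ∀ u v w x : V, D u v → D v w → D w x → D u x) :
    ∃ N : Set V, (∀ u ∈ N, ∀ v ∈ N, u ≠ v → ¬ D u v) ∧
      (∀ u : V, u ∉ N → ∃ v ∈ N, D u v) := by
  induction hn : Nat.card V using Nat.strong_induction_on generalizing V with
  | _ n ih =>
  rcases isEmpty_or_nonempty V with hV | hV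
  · exact ⟨∅, by simp, fun u => isEmptyElim u⟩
  obtain ⟨u, hu⟩ := exists_forall_reflTransGen_symm D
  let N₀ : Set V := {v | v = u ∨ ∃ w, D u w ∧ D w v}
  have huN : u ∈ N₀ := Or.inl rfl
  have hout : ∀ v ∈ N₀, ∀ x, D v x → D u x := by
    rintro v (rfl | ⟨w, h, h'⟩) x hx
    · exact hx
    · exact h3 _ _ _ _ h h' hx
  have hback : ∀ x, D u x → D x u := by
    intro x hx
    rcases reflTransGen_cases_of_three_transitive h3 (hu x (.single hx)) with rfl | h | ⟨w, h, h'⟩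
    · exact hx
    · exact h
    · exact absurd (h3 _ _ _ _ hx h h') (hloop u)
  have hindep : ∀ v ∈ N₀, ∀ x ∈ N₀, ¬ D v x := by
    rintro v hv x (rfl | ⟨w, h, h'⟩) hx
    · exact hloop _ (hout v hv _ hx)
    · exact hloop _ (h3 _ _ _ _ h h' (hback _ (hout v hv _ hx)))
  let S : Set V := {x | x ∉ N₀ ∧ ∀ v ∈ N₀, ¬ D x v}
  have hcard : Nat.card S < n := by
    rw [← hn]
    exact Finite.card_subtype_lt (x := u) fun h => h.1 huN
  obtain ⟨N₁, hN₁, hN₁'⟩ := ih _ hcard (fun x y : S => D x y) (fun x => hloop x)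
    (fun _ _ _ _ => h3 _ _ _ _) rfl
  refine ⟨N₀ ∪ Subtype.val '' N₁, ?_, ?_⟩
  · rintro v (hv | ⟨v, hv, rfl⟩) x (hx | ⟨x, hx, rfl⟩) hne
    · exact hindep v hv x hx
    · exact fun h => x.2.2 u huN (hback _ (hout v hv _ h))
    · exact v.2.2 x hx
    · exact hN₁ v hv x hx fun h => hne (congrArg _ h)
  · intro x hx
    by_cases hxS : x ∈ S
    · obtain ⟨v, hv, h⟩ := hN₁' ⟨x, hxS⟩ fun h => hx (Or.inr ⟨_, h, rfl⟩)
      exact ⟨v, Or.inr ⟨v, hv, rfl⟩, h⟩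
    · by_contra! hno
      exact hxS ⟨fun h => hx (Or.inl h), fun v hv => hno v (Or.inl hv)⟩

theorem statement_11
    {V : Type*} [Fintype V]
    (D H₁ H₂ : V → V → Prop)
    (hloop : ∀ v : V, ¬ D v v)
    (h3trans : ∀ u v w x : V, D u v → D v w → D w x → D u x)
    (hsub1 : ∀ u v : V, H₁ u v → D u v)
    (hsub2 : ∀ u v : V, H₂ u v → D u v)
    (hdisj : ∀ u v : V, ¬ (H₁ u v ∧ H₂ u v))
    (hunion : ∀ u v : V, D u v → H₁ u v ∨ H₂ u v)
    (hnoC3 : ¬ ∃ a b d : V, a ≠ b ∧ b ≠ d ∧ a ≠ d ∧ D a b ∧ D b d ∧ D d a)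
    (hac1 : ∀ γ : List V, ¬ IsCycle H₁ γ)
    (hac2 : ∀ γ : List V, ¬ IsCycle H₂ γ) :
    ∃ N : Set V, (∀ u ∈ N, ∀ v ∈ N, u ≠ v → ¬ D u v) ∧
      (∀ u : V, u ∉ N → ∃ v ∈ N, D u v) :=
  exists_kernel_of_three_transitive D hloop h3trans
end

section
/- Let D be a finite m-colored digraph. If the color-class digraph 𝒞_C(D) is a bipartite digraph, then D has a kernel by monochromatic paths (mp-kernel). -/
/- Digraphs are modeled as binary relations on a vertex type.  An `H`-colored digraph `D`
is a relation `D : V → V → Prop` together with a coloring `c : V → V → β` of its arcs by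
vertices of a digraph `H : β → β → Prop` (possibly with loops). -/

variable {V β : Type*}

theorem HPathExists.of_arc {V β : Type*} {D : V → V → Prop} (c : V → V → β)
    (H : β → β → Prop) {u v : V} (huv : D u v) (hne : u ≠ v) : HPathExists D c H u v :=
  ⟨[u, v], by simp [IsHPathFrom, IsHPath, IsHWalk, arcColors, List.Chain', huv, hne]⟩

/-- If no color can follow itself, monochromatic paths are single arcs. -/
theorem HPathExists.arc_of_not_ccArc {V β : Type*} {D : V → V → Prop} {c : V → V → β}
    (hcc : ∀ a, ¬ CCArc D c a a) {u v : V}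
    (h : HPathExists D c (fun a b : β => a = b) u v) : D u v := by
  obtain ⟨l, ⟨⟨⟨hlen, hch, hcol⟩, -⟩, hhead, hlast⟩⟩ := h
  match l with
  | [] => simp at hlen
  | [_] => simp at hlen
  | [x, y] =>
    simp_all [List.Chain']
  | x :: y :: z :: l =>
    simp only [List.Chain', arcColors, List.tail_cons, List.zip_cons_cons, List.map_cons,
      List.isChain_cons_cons] at hch hcol
    exact (hcc (c x y) ⟨x, y, z, hch.1, hch.2.1, rfl, hcol.1.symm⟩).elim

/-- A pair of mutually dual sets for two relations, obtained from the Knaster–Tarski theorem. -/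
theorem exists_dual_pair {V : Type*} (A B : V → V → Prop) :
    ∃ S T : Set V, (∀ x, x ∈ S ↔ ∀ y, A x y → y ∉ T) ∧ (∀ y, y ∈ T ↔ ∀ z, B y z → z ∉ S) := by
  let f : Set V →o Set V :=
    { toFun := fun S => {x | ∀ y, A x y → ∃ z, B y z ∧ z ∈ S}
      monotone' := fun S T hST x hx y hy =>
        let ⟨z, hz, hzS⟩ := hx y hy
        ⟨z, hz, hST hzS⟩ }
  refine ⟨f.lfp, {y | ∀ z, B y z → z ∉ f.lfp}, fun x => ?_, fun y => Iff.rfl⟩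
  have hx : x ∈ f.lfp ↔ x ∈ f f.lfp := by rw [f.map_lfp]
  rw [hx]
  change (∀ y, A x y → ∃ z, B y z ∧ z ∈ f.lfp) ↔ _
  simp

/-- A digraph whose arcs are covered by two relations, neither of which can follow itself,
has a kernel. -/
theorem exists_kernel_of_alternating {V : Type*} {D A B : V → V → Prop}
    (hD : ∀ u v, D u v ↔ A u v ∨ B u v) (hA : ∀ u v w, A u v → ¬ A v w)
    (hB : ∀ u v w, B u v → ¬ B v w) :
    ∃ N : Set V, (∀ u ∈ N, ∀ v ∈ N, ¬ D u v) ∧ ∀ u, u ∉ N → ∃ v ∈ N, D u v := by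
  obtain ⟨S, T, hS, hT⟩ := exists_dual_pair A B
  refine ⟨S ∩ T, fun u hu v hv huv => ?_, fun u hu => ?_⟩
  · rcases (hD u v).1 huv with h | h
    · exact (hS u).1 hu.1 v h hv.2
    · exact (hT u).1 hu.2 v h hv.1
  · by_cases huS : u ∈ S
    · have huT : u ∉ T := fun h => hu ⟨huS, h⟩
      rw [hT] at huT
      push Not at huT
      obtain ⟨v, huv, hv⟩ := huT
      exact ⟨v, ⟨hv, (hT v).2 fun w hw => (hB u v w huv hw).elim⟩, (hD u v).2 (.inr huv)⟩
    · rw [hS] at huS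
      push Not at huS
      obtain ⟨v, huv, hv⟩ := huS
      exact ⟨v, ⟨(hS v).2 fun w hw => (hA u v w huv hw).elim, hv⟩, (hD u v).2 (.inl huv)⟩

theorem statement_12
    {V β : Type*} [Fintype V] [Fintype β]
    (D : V → V → Prop) (c : V → V → β)
    (hloop : ∀ v : V, ¬ D v v)
    (hbip : ∃ X Y : Set β,
        (∀ a ∈ X, ∃ u v : V, D u v ∧ c u v = a) ∧
        (∀ a ∈ Y, ∃ u v : V, D u v ∧ c u v = a) ∧
        (∀ a : β, (∃ u v : V, D u v ∧ c u v = a) → a ∈ X ∨ a ∈ Y) ∧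
        Disjoint X Y ∧
        (∀ a ∈ X, ∀ b ∈ X, ¬ CCArc D c a b) ∧
        (∀ a ∈ Y, ∀ b ∈ Y, ¬ CCArc D c a b)) :
    ∃ N : Set V, IsHKernel D c (fun a b : β => a = b) N := by
  obtain ⟨X, Y, -, -, hcov, -, hX, hY⟩ := hbip
  have hcc : ∀ a, ¬ CCArc D c a a := by
    intro a h
    obtain ⟨u, v, _, huv, -, ha, -⟩ := id h
    exact (hcov a ⟨u, v, huv, ha⟩).elim (fun ha => hX a ha a ha h) fun ha => hY a ha a ha h
  have hno {Z : Set β} (hZ : ∀ a ∈ Z, ∀ b ∈ Z, ¬ CCArc D c a b) (u v w : V)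
      (huv : Garc D c Z u v) : ¬ Garc D c Z v w := fun hvw =>
    hZ _ huv.2 _ hvw.2 ⟨u, v, w, huv.1, hvw.1, rfl, rfl⟩
  have hD : ∀ u v, D u v ↔ Garc D c X u v ∨ Garc D c Y u v := fun u v =>
    ⟨fun h => (hcov _ ⟨u, v, h, rfl⟩).imp (⟨h, ·⟩) (⟨h, ·⟩), fun h => h.elim (·.1) (·.1)⟩
  obtain ⟨N, hind, habs⟩ := exists_kernel_of_alternating hD (hno hX) (hno hY)
  refine ⟨N, fun u hu v hv _ h => hind u hu v hv (h.arc_of_not_ccArc hcc), fun u hu => ?_⟩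
  obtain ⟨v, hv, huv⟩ := habs u hu
  exact ⟨v, hv, .of_arc c _ huv fun h => hloop v (h ▸ huv)⟩
end

section
/- Let D be a finite m-colored digraph, {u, v, w} a set of three pairwise distinct vertices of D, P_1 a uv-path in D and P_2 a vw-path in D. Suppose that every chromatic class of D is transitive. If P_1 and P_2 are properly colored paths, then there exists a uw-properly colored path in D. -/
/- Digraphs are modeled as binary relations on a vertex type.  An `H`-colored digraph `D`
is a relation `D : V → V → Prop` together with a coloring `c : V → V → β` of its arcs by
vertices of a digraph `H : β → β → Prop` (possibly with loops). -/

variable {V β : Type*}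

theorem arcColors_cons_cons {V β : Type*} (c : V → V → β) (a b : V) (l : List V) :
    arcColors c (a :: b :: l) = c a b :: arcColors c (b :: l) := rfl

theorem arcColors_suffix_append {V β : Type*} (c : V → V → β) (s l : List V) :
    arcColors c l <:+ arcColors c (s ++ l) := by
  induction s with
  | nil => exact List.suffix_rfl
  | cons a s ih =>
    refine ih.trans ?_
    rw [List.cons_append]
    cases s ++ l with
    | nil => exact List.suffix_rfl
    | cons b t => exact List.suffix_cons _ _

/-- A possibly trivial properly colored path from `u` to `w`, recorded as a list of vertices. -/
structure IsProperPath {V β : Type*} (D : V → V → Prop) (c : V → V → β) (u w : V)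
    (l : List V) : Prop where
  chain : l.IsChain D
  proper : (arcColors c l).IsChain (· ≠ ·)
  nodup : l.Nodup
  head : l.head? = some u
  last : l.getLast? = some w

theorem IsProperPath.hPathExists {V β : Type*} {D : V → V → Prop} {c : V → V → β} {u w : V}
    {l : List V} (h : IsProperPath D c u w l) (huw : u ≠ w) :
    HPathExists D c (fun a b : β => a ≠ b) u w := by
  refine ⟨l, ⟨⟨?_, h.chain, h.proper⟩, h.nodup⟩, h.head, h.last⟩
  match l, h.head, h.last with
  | [a], h1, h2 => simp_all
  | _ :: _ :: _, _, _ => simp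

theorem IsProperPath.exists_cons {V β : Type*} {D : V → V → Prop} {c : V → V → β}
    (htrans : ∀ a b d : V, D a b → D b d → c a b = c b d → D a d ∧ c a d = c a b)
    {u x w : V} {l : List V} (h : IsProperPath D c x w l) (hux : D u x) :
    ∃ l', IsProperPath D c u w l' := by
  obtain ⟨h1, h2, h3, h4, h5⟩ := h
  by_cases hu : u ∈ l
  · obtain ⟨s, t, rfl⟩ := List.append_of_mem hu
    exact ⟨u :: t, h1.suffix (List.suffix_append _ _),
      h2.suffix (arcColors_suffix_append c s _), h3.of_append_right, rfl,
      by simpa [List.getLast?_append] using h5⟩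
  match l, h4 with
  | [y], h4 =>
    obtain rfl : y = x := by simpa using h4
    exact ⟨[u, y], by simpa using hux, by simp [arcColors], by simpa using hu, rfl,
      by simpa using h5⟩
  | y :: z :: t, h4 =>
    obtain rfl : y = x := by simpa using h4
    rw [List.isChain_cons_cons] at h1
    by_cases hc : c u y = c y z
    · obtain ⟨hd, hcz⟩ := htrans u y z hux h1.1 hc
      refine ⟨u :: z :: t, List.isChain_cons_cons.2 ⟨hd, h1.2⟩, ?_, ?_, rfl, ?_⟩
      · rw [arcColors_cons_cons] at h2 ⊢
        rwa [hcz, hc]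
      · exact List.nodup_cons.2 ⟨fun h => hu (List.mem_cons_of_mem _ h), h3.of_cons⟩
      · simpa using h5
    · refine ⟨u :: y :: z :: t, ?_, ?_, List.nodup_cons.2 ⟨hu, h3⟩, rfl, by simpa using h5⟩
      · exact List.isChain_cons_cons.2 ⟨hux, List.isChain_cons_cons.2 h1⟩
      · rw [arcColors_cons_cons, arcColors_cons_cons] at *
        exact List.isChain_cons_cons.2 ⟨hc, h2⟩

theorem IsProperPath.exists_append {V β : Type*} {D : V → V → Prop} {c : V → V → β}
    (htrans : ∀ a b d : V, D a b → D b d → c a b = c b d → D a d ∧ c a d = c a b)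
    {v w : V} {l : List V} (h : IsProperPath D c v w l) :
    ∀ {u : V} (p : List V), p.IsChain D → p.head? = some u → p.getLast? = some v →
      ∃ l', IsProperPath D c u w l'
  | u, [a], _, hh, hl => by
    obtain rfl : a = u := by simpa using hh
    obtain rfl : a = v := by simpa using hl
    exact ⟨l, h⟩
  | u, a :: b :: p, hp, hh, hl => by
    obtain rfl : a = u := by simpa using hh
    rw [List.isChain_cons_cons] at hp
    obtain ⟨l', h'⟩ := h.exists_append htrans (b :: p) hp.2 rfl (by simpa using hl)
    exact h'.exists_cons htrans hp.1

theorem statement_13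
    {V β : Type*} [Fintype V] [Fintype β]
    (D : V → V → Prop) (c : V → V → β)
    (hloop : ∀ v : V, ¬ D v v)
    (htrans : ∀ a b d : V, D a b → D b d → c a b = c b d → D a d ∧ c a d = c a b)
    (u v w : V) (huv : u ≠ v) (huw : u ≠ w) (hvw : v ≠ w)
    (P₁ P₂ : List V)
    (hP₁ : IsHPathFrom D c (fun a b : β => a ≠ b) u v P₁)
    (hP₂ : IsHPathFrom D c (fun a b : β => a ≠ b) v w P₂) :
    HPathExists D c (fun a b : β => a ≠ b) u w := by
  obtain ⟨⟨⟨-, h1, h2⟩, h3⟩, h4, h5⟩ := hP₂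
  obtain ⟨l, hl⟩ := IsProperPath.exists_append htrans ⟨h1, h2, h3, h4, h5⟩ P₁
    hP₁.1.1.2.1 hP₁.2.1 hP₁.2.2
  exact hl.hPathExists huw
end

section
/- Let D be a finite m-colored digraph in which every chromatic class is transitive. If the color-class digraph 𝒞_C(D) contains no directed cycle of length at least two, then every properly colored directed path in D is a rainbow path. -/
/- Digraphs are modeled as binary relations on a vertex type.  An `H`-colored digraph `D`
is a relation `D : V → V → Prop` together with a coloring `c : V → V → β` of its arcs by
vertices of a digraph `H : β → β → Prop` (possibly with loops). -/

variable {V β : Type*}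

/-- A chain for the irreflexive part of a relation without directed cycles of length at least
two has no repeated entries. -/
theorem nodup_of_isChain_of_no_cycle {α : Type*} {R : α → α → Prop}
    (hR : ∀ γ : List α, ¬ IsCycle R γ) :
    ∀ l : List α, l.IsChain R → l.IsChain (· ≠ ·) → l.Nodup
  | [], _, _ => List.nodup_nil
  | a :: t, hl, hne => by
    have ht : t.Nodup := nodup_of_isChain_of_no_cycle hR t hl.tail hne.tail
    refine List.nodup_cons.2 ⟨fun ha => ?_, ht⟩
    obtain ⟨s, r, rfl⟩ := List.append_of_mem ha
    rw [← List.cons_append, List.isChain_append] at hl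
    have hs : s ≠ [] := by
      rintro rfl
      simp at hne
    rw [List.nodup_append] at ht
    refine hR (a :: s) ⟨?_, ?_, hl.1, fun x hx y hy => hl.2.2 x hx y (by simpa using hy)⟩
    · have := List.length_pos_iff.2 hs
      simp only [List.length_cons]
      omega
    · exact List.nodup_cons.2 ⟨fun h => ht.2.2 a h a List.mem_cons_self rfl, ht.1⟩

/-- The colors along a walk of `D` form a walk in the color-class digraph. -/
theorem isChain_arcColors {V β : Type*} {D : V → V → Prop} (c : V → V → β) :
    ∀ {l : List V}, l.IsChain D → (arcColors c l).IsChain (CCArc D c)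
  | [], _ => by simp [arcColors]
  | [_], _ => by simp [arcColors]
  | [_, _], _ => by simp [arcColors]
  | x :: y :: z :: t, h => by
    rw [List.isChain_cons_cons] at h
    have ih := isChain_arcColors c h.2
    rw [List.isChain_cons_cons] at h
    have hxyz : CCArc D c (c x y) (c y z) := ⟨x, y, z, h.1, h.2.1, rfl, rfl⟩
    exact List.isChain_cons_cons.2 ⟨hxyz, ih⟩

theorem statement_14
    {V β : Type*} [Fintype V] [Fintype β]
    (D : V → V → Prop) (c : V → V → β)
    (hloop : ∀ v : V, ¬ D v v)
    (htrans : ∀ a b d : V, D a b → D b d → c a b = c b d → D a d ∧ c a d = c a b)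
    (hnocyc : ∀ γ : List β, ¬ IsCycle (CCArc D c) γ) :
    ∀ P : List V, IsHPath D c (fun a b : β => a ≠ b) P → (arcColors c P).Nodup := by
  rintro P ⟨⟨-, hD, hne⟩, -⟩
  exact nodup_of_isChain_of_no_cycle hnocyc _ (isChain_arcColors c hD) hne
end

section
/- Let D be a finite m-colored digraph without isolated vertices. If every chromatic class of D is transitive, then D has a PCP-kernel (kernel by properly colored paths). -/
/- Digraphs are modeled as binary relations on a vertex type.  An `H`-colored digraph `D`
is a relation `D : V → V → Prop` together with a coloring `c : V → V → β` of its arcs by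
vertices of a digraph `H : β → β → Prop` (possibly with loops). -/

variable {V β : Type*}

/-- A shortest walk to `v` is properly colored when every chromatic class is transitive. -/
theorem isChain_arcColors_and_nodup_of_minimal {V β : Type*} {D : V → V → Prop} {c : V → V → β}
    (htrans : ∀ a b d : V, D a b → D b d → c a b = c b d → D a d ∧ c a d = c a b) {v : V}
    (l : List V) (hl : l.IsChain D) (hlast : l.getLast? = some v)
    (hmin : ∀ l' : List V, l'.IsChain D → l'.head? = l.head? → l'.getLast? = some v →
      l.length ≤ l'.length) :
    (arcColors c l).IsChain (· ≠ ·) ∧ l.Nodup := by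
  induction l with
  | nil => simp at hlast
  | cons x t ih =>
    rcases t with _ | ⟨y, t⟩
    · simp [arcColors]
    have hxy : D x y := (List.isChain_cons_cons.1 hl).1
    have hyt : (y :: t).IsChain D := (List.isChain_cons_cons.1 hl).2
    obtain ⟨hcol, hnodup⟩ := ih hyt (by simpa using hlast) fun l' hl' hhead hlast' => by
      rcases l' with _ | ⟨y', t'⟩
      · simp at hlast'
      obtain rfl : y' = y := by simpa using hhead
      simpa using hmin (x :: y' :: t') (List.isChain_cons_cons.2 ⟨hxy, hl'⟩) rfl
        (by simpa using hlast')
    refine ⟨?_, List.nodup_cons.2 ⟨fun hx => ?_, hnodup⟩⟩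
    · rcases t with _ | ⟨z, t⟩
      · simp [arcColors]
      refine List.isChain_cons_cons.2 ⟨fun h => ?_, hcol⟩
      obtain ⟨hyz, hzt⟩ := List.isChain_cons_cons.1 hyt
      have := hmin (x :: z :: t) (List.isChain_cons_cons.2 ⟨(htrans x y z hxy hyz h).1, hzt⟩) rfl
        (by simpa using hlast)
      simp at this
    · obtain ⟨s, r, hsr⟩ := List.append_of_mem hx
      rw [hsr] at hyt hlast hmin
      have := hmin (x :: r) hyt.right_of_append rfl (by
        simpa [List.getLast?_cons, List.getLast?_append] using hlast)
      simp at this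
      omega

/-- If every chromatic class is transitive, every reachable vertex is reachable by a properly
colored path. -/
theorem hPathExists_ne_of_reflTransGen {V β : Type*} {D : V → V → Prop} {c : V → V → β}
    (htrans : ∀ a b d : V, D a b → D b d → c a b = c b d → D a d ∧ c a d = c a b) {u v : V}
    (huv : Relation.ReflTransGen D u v) (hne : u ≠ v) :
    HPathExists D c (fun a b => a ≠ b) u v := by
  have hex : ∃ l : List V, l.IsChain D ∧ l.head? = some u ∧ l.getLast? = some v := by
    obtain ⟨t, ht, hlast⟩ := List.exists_isChain_cons_of_relationReflTransGen huv
    exact ⟨u :: t, ht, rfl, by rw [List.getLast?_eq_some_getLast (by simp), hlast]⟩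
  let S : Set (List V) := {l | l.IsChain D ∧ l.head? = some u ∧ l.getLast? = some v}
  obtain ⟨l, ⟨hl, hhead, hlast⟩, hmin⟩ :=
    (WellFounded.onFun (f := List.length) (wellFounded_lt (α := ℕ))).has_min S hex
  obtain ⟨hcol, hnodup⟩ := isChain_arcColors_and_nodup_of_minimal htrans l hl hlast
    fun l' hl' hhead' hlast' => not_lt.1 (hmin l' ⟨hl', hhead'.trans hhead, hlast'⟩)
  refine ⟨l, ⟨⟨⟨?_, hl, hcol⟩, hnodup⟩, hhead, hlast⟩⟩
  match l, hhead, hlast with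
  | [], hhead, _ => simp at hhead
  | [x], hhead, hlast => simp_all
  | _ :: _ :: _, _, _ => simp

theorem HPathExists.reflTransGen {V β : Type*} {D : V → V → Prop} {c : V → V → β}
    {H : β → β → Prop} {u v : V} (h : HPathExists D c H u v) : Relation.ReflTransGen D u v := by
  obtain ⟨l, ⟨⟨⟨-, hl, -⟩, -⟩, hhead, hlast⟩⟩ := h
  rcases l with _ | ⟨x, t⟩
  · simp at hhead
  obtain rfl : x = u := by simpa using hhead
  exact List.relationReflTransGen_of_exists_isChain_cons t hl
    (by simpa [List.getLast?_eq_some_getLast] using hlast)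

theorem statement_15
    {V β : Type*} [Fintype V] [Fintype β]
    (D : V → V → Prop) (c : V → V → β)
    (hloop : ∀ v : V, ¬ D v v)
    (hnoiso : ∀ v : V, ∃ u : V, D v u ∨ D u v)
    (htrans : ∀ a b d : V, D a b → D b d → c a b = c b d → D a d ∧ c a d = c a b) :
    ∃ N : Set V, IsHKernel D c (fun a b : β => a ≠ b) N := by
  let _ : Preorder V :=
    { le := Relation.ReflTransGen D
      le_refl := fun _ => .refl
      le_trans := fun _ _ _ => .trans }
  have hout (m : V) : AntisymmRel (· ≤ ·) (toAntisymmetrization (· ≤ ·) m).out m :=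
    Quotient.exact (Quotient.out_eq (toAntisymmetrization (· ≤ ·) m))
  refine ⟨{m | IsMax m ∧ (toAntisymmetrization (· ≤ ·) m).out = m}, ?_, fun u hu => ?_⟩
  · rintro u ⟨humax, hu⟩ v ⟨-, hv⟩ hne h
    have huv : u ≤ v := h.reflTransGen
    have heq : toAntisymmetrization (· ≤ ·) u = toAntisymmetrization (· ≤ ·) v :=
      Quotient.sound ⟨huv, humax huv⟩
    exact hne (by rw [← hu, ← hv, heq])
  · obtain ⟨m, hum, hm⟩ := Finite.exists_le_maximal (p := fun _ : V => True) (a := u) trivial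
    have hmmax : IsMax m := fun x hx => hm.2 trivial hx
    obtain ⟨h₁, h₂⟩ := hout m
    set w := (toAntisymmetrization (· ≤ ·) m).out
    have hwN : IsMax w ∧ (toAntisymmetrization (· ≤ ·) w).out = w := by
      refine ⟨fun x hx => (hmmax (h₂.trans hx)).trans h₂, ?_⟩
      rw [show toAntisymmetrization (· ≤ ·) w = toAntisymmetrization (· ≤ ·) m from
        Quotient.sound ⟨h₁, h₂⟩]
    exact ⟨w, hwN, hPathExists_ne_of_reflTransGen htrans (hum.trans h₂)
      fun h => hu (h ▸ hwN)⟩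
end
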